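/- For every natural number n, the Fibonacci quaternion F_n is a zero divisor in H[Z_5] (equivalently, F_n is not a unit) if and only if n ≡ 1 (mod 5). -/

import Mathlib

open Quaternion

/-- The n-th Fibonacci quaternion over a commutative ring `R`:
`F_n = f_n + f_{n+1}·i + f_{n+2}·j + f_{n+3}·k` in `ℍ[R] = H(-1,-1)`. -/
def fibQuat (R : Type*) [CommRing R] (n : ℕ) : ℍ[R] :=
  ⟨(Nat.fib n : R), (Nat.fib (n + 1) : R), (Nat.fib (n + 2) : R), (Nat.fib (n + 3) : R)⟩

theorem Quaternion.isUnit_iff_isUnit_normSq {R : Type*} [CommRing R] (a : ℍ[R]) :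
    IsUnit a ↔ IsUnit (normSq a) := by
  refine ⟨fun h ↦ h.map normSq, fun h ↦ ?_⟩
  have hc : IsUnit ((normSq a : R) : ℍ[R]) := h.map (algebraMap R ℍ[R])
  have hcomm : Commute a (star a) := by
    rw [Commute, SemiconjBy, self_mul_star, star_mul_self]
  rw [← self_mul_star] at hc
  exact (hcomm.isUnit_mul_iff.1 hc).1

theorem Nat.fib_sq_add_four_consecutive (n : ℕ) :
    fib n ^ 2 + fib (n + 1) ^ 2 + fib (n + 2) ^ 2 + fib (n + 3) ^ 2 = 3 * fib (2 * n + 3) := by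
  have h₁ := fib_two_mul_add_one n
  have h₂ := fib_two_mul_add_one (n + 2)
  have h₃ : fib (2 * n + 3) = fib (2 * n + 1) + fib (2 * n + 2) := fib_add_two
  have h₄ : fib (2 * n + 4) = fib (2 * n + 2) + fib (2 * n + 3) := fib_add_two
  have h₅ : fib (2 * n + 5) = fib (2 * n + 3) + fib (2 * n + 4) := fib_add_two
  rw [show 2 * (n + 2) + 1 = 2 * n + 5 by ring] at h₂
  linarith

theorem normSq_fibQuat (R : Type*) [CommRing R] (n : ℕ) :
    normSq (fibQuat R n) = ((3 * Nat.fib (2 * n + 3) : ℕ) : R) := by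
  rw [← Nat.fib_sq_add_four_consecutive, normSq_def']
  simp [fibQuat]

theorem Nat.five_dvd_fib_iff (m : ℕ) : 5 ∣ fib m ↔ 5 ∣ m := by
  refine ⟨fun h ↦ ?_, fib_dvd 5 m⟩
  by_contra hm
  have hg : Nat.gcd 5 m = 1 := (Nat.Prime.coprime_iff_not_dvd prime_five).2 hm
  have h₁ := fib_gcd 5 m
  rw [hg, show fib 5 = 5 from rfl, Nat.gcd_eq_left h] at h₁
  simp at h₁

theorem fibQuat_zeroDivisor_iff_mod_five (n : ℕ) :
    ¬ IsUnit (fibQuat (ZMod 5) n) ↔ n % 5 = 1 := by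
  have : Fact (Nat.Prime 5) := ⟨Nat.prime_five⟩
  rw [isUnit_iff_isUnit_normSq, normSq_fibQuat, isUnit_iff_ne_zero, not_not,
    ZMod.natCast_eq_zero_iff, Nat.Coprime.dvd_mul_left (by norm_num), Nat.five_dvd_fib_iff]
  omega
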